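/- Let w ∈ S_N and suppose there exist distinct k < k' in newrep(w) with 𝔭_k(w) = 𝔭_{k'}(w). Writing M = M_{k'} and m = m_{k'}, the letters {N, M, w̄(k')} and {N, w̄(k'), m} each form an N-occurrence of the pattern 321 in w, these two occurrences are distinct, and neither is equal to 𝔭_j(w) for any j ∈ newrep(w). -/

import Mathlib

/-!
Common framework.  Permutations of `{1, …, m}` are modelled as `Equiv.Perm (Fin m)`
with 0-based positions and values.  The simple reflection `sr m i` (for
`0 ≤ i ≤ m - 2`, corresponding to the paper's `s_{i+1}`) swaps the values `i` and
`i + 1`.  Cut statistics `Mstat w k` / `mstat w k` (the paper's `M_{k+1}`/`m_{k+1}`)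
are respectively the maximum of the first `k + 1` entries and the minimum of the
remaining entries of the one-line notation of `w`.
-/

/-- The simple reflection swapping `i` and `i + 1` (0-based) in the symmetric group
on `Fin m`; the identity if out of range. -/
def sr (m i : ℕ) : Equiv.Perm (Fin m) :=
  if h : i + 1 < m then Equiv.swap ⟨i, Nat.lt_of_succ_lt h⟩ ⟨i + 1, h⟩ else 1

/-- `l` is a word in the simple reflections whose product is `w`. -/
def IsWord (m : ℕ) (l : List ℕ) (w : Equiv.Perm (Fin m)) : Prop :=
  (∀ i ∈ l, i + 1 < m) ∧ (l.map (sr m)).prod = w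

/-- The Coxeter length `ℓ(w)`: the minimal length of a word expressing `w`. -/
noncomputable def len {m : ℕ} (w : Equiv.Perm (Fin m)) : ℕ :=
  sInf {c | ∃ l : List ℕ, IsWord m l w ∧ l.length = c}

/-- `l` is a reduced decomposition of `w`. -/
def IsReducedWord {m : ℕ} (w : Equiv.Perm (Fin m)) (l : List ℕ) : Prop :=
  IsWord m l w ∧ l.length = len w

/-- The support of `w`: the letters appearing in some reduced decomposition. -/
noncomputable def supp {m : ℕ} (w : Equiv.Perm (Fin m)) : Set ℕ :=
  {i | ∃ l : List ℕ, IsReducedWord w l ∧ i ∈ l}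

/-- `rep w = ℓ(w) - |supp w|`, the number of repeated letters. -/
noncomputable def rep {m : ℕ} (w : Equiv.Perm (Fin m)) : ℕ :=
  len w - (supp w).ncard

/-- The value of `w` at the (0-based) position `i`, as a natural number. -/
def valAt {m : ℕ} (w : Equiv.Perm (Fin m)) (i : ℕ) : ℕ :=
  if h : i < m then (w ⟨i, h⟩ : ℕ) else 0

/-- The (0-based) position at which the value `v` occurs in `w`. -/
def posOf {m : ℕ} (w : Equiv.Perm (Fin m)) (v : ℕ) : ℕ :=
  if h : v < m then (w⁻¹ ⟨v, h⟩ : ℕ) else 0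

/-- `Mstat w k`: the maximum of the first `k + 1` entries of `w`. -/
noncomputable def Mstat {m : ℕ} (w : Equiv.Perm (Fin m)) (k : ℕ) : ℕ :=
  sSup {v | ∃ i : Fin m, (i : ℕ) ≤ k ∧ (w i : ℕ) = v}

/-- `mstat w k`: the minimum of the entries of `w` in positions `> k`. -/
noncomputable def mstat {m : ℕ} (w : Equiv.Perm (Fin m)) (k : ℕ) : ℕ :=
  sInf {v | ∃ i : Fin m, k < (i : ℕ) ∧ (w i : ℕ) = v}

/-- `wbar` is obtained from `w` by deleting the largest letter from the one-line
notation of `w` and sliding all subsequent letters one space to the left. -/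
def IsDeletion {n : ℕ} (w : Equiv.Perm (Fin (n + 1))) (wbar : Equiv.Perm (Fin n)) : Prop :=
  ∀ i : Fin n, (wbar i : ℕ) =
    if (i : ℕ) < posOf w n then valAt w (i : ℕ) else valAt w ((i : ℕ) + 1)

/-- `newrep w wbar`: the letters `k` with `s_k ∈ supp(wbar)` and `w⁻¹(top) ≤ k`. -/
noncomputable def newrep {n : ℕ} (w : Equiv.Perm (Fin (n + 1))) (wbar : Equiv.Perm (Fin n)) :
    Set ℕ :=
  {k | k ∈ supp wbar ∧ posOf w n ≤ k}

/-- An occurrence of the pattern `p` in `w`, recorded by its set `S` of values: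
there are positions `f 0 < f 1 < ⋯` whose values are in the same relative order
as `p`, and `S` is the corresponding set of values. -/
def IsOccSet {m c : ℕ} (p : Fin c → ℕ) (w : Equiv.Perm (Fin m)) (S : Finset ℕ) : Prop :=
  ∃ f : Fin c → Fin m, StrictMono f ∧ (∀ a b : Fin c, p a < p b ↔ w (f a) < w (f b)) ∧
    S = Finset.image (fun a => (w (f a) : ℕ)) Finset.univ

/-- An `N`-occurrence (here `N = n`, the largest 0-based value): an occurrence
whose largest letter is the largest value of `w`. -/
def IsTopOccSet {n c : ℕ} (p : Fin c → ℕ) (w : Equiv.Perm (Fin (n + 1))) (S : Finset ℕ) : Prop :=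
  IsOccSet p w S ∧ n ∈ S

/-- The number of occurrences of the pattern `p` in `w`. -/
noncomputable def occCount {m c : ℕ} (p : Fin c → ℕ) (w : Equiv.Perm (Fin m)) : ℕ :=
  Set.ncard {S : Finset ℕ | IsOccSet p w S}

/-- The number of `N`-occurrences of the pattern `p` in `w`. -/
noncomputable def topOccCount {n c : ℕ} (p : Fin c → ℕ) (w : Equiv.Perm (Fin (n + 1))) : ℕ :=
  Set.ncard {S : Finset ℕ | IsTopOccSet p w S}

def p321 : Fin 3 → ℕ := ![3, 2, 1]
def p3412 : Fin 4 → ℕ := ![3, 4, 1, 2]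
def p4321 : Fin 4 → ℕ := ![4, 3, 2, 1]
def p34512 : Fin 5 → ℕ := ![3, 4, 5, 1, 2]
def p45123 : Fin 5 → ℕ := ![4, 5, 1, 2, 3]
def p35412 : Fin 5 → ℕ := ![3, 5, 4, 1, 2]
def p43512 : Fin 5 → ℕ := ![4, 3, 5, 1, 2]
def p45132 : Fin 5 → ℕ := ![4, 5, 1, 3, 2]
def p45213 : Fin 5 → ℕ := ![4, 5, 2, 1, 3]
def p53412 : Fin 5 → ℕ := ![5, 3, 4, 1, 2]
def p45312 : Fin 5 → ℕ := ![4, 5, 3, 1, 2]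
def p45231 : Fin 5 → ℕ := ![4, 5, 2, 3, 1]

/-- The pattern `𝔭_k(w)` of Definition 4.4, recorded as its set of values:
(I) if `w⁻¹(top)` is left of `w⁻¹(M_k)`, the 321-occurrence `{top, M_k, m_k}`;
(II) else if `wbar(k) > m_k`, the 321-occurrence `{top, wbar(k), m_k}`;
(III) otherwise the 3412-occurrence `{M_k, top, wbar(k), m_k}`. -/
noncomputable def pocc {n : ℕ} (w : Equiv.Perm (Fin (n + 1))) (wbar : Equiv.Perm (Fin n))
    (k : ℕ) : Finset ℕ :=
  if posOf w n < posOf w (Mstat wbar k) then {n, Mstat wbar k, mstat wbar k}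
  else if mstat wbar k < valAt wbar k then {n, valAt wbar k, mstat wbar k}
  else {Mstat wbar k, n, valAt wbar k, mstat wbar k}

section Words

variable {m : ℕ}

theorem sr_of_lt {a : ℕ} (h : a + 1 < m) :
    sr m a = Equiv.swap ⟨a, Nat.lt_of_succ_lt h⟩ ⟨a + 1, h⟩ := by
  simp [sr, h]

theorem val_sr {a : ℕ} (h : a + 1 < m) (i : Fin m) :
    (sr m a i : ℕ) = if (i : ℕ) = a then a + 1 else if (i : ℕ) = a + 1 then a else i := by
  rw [sr_of_lt h, Equiv.swap_apply_def]
  simp only [Fin.ext_iff]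
  split_ifs <;> rfl

theorem sr_mul_self (a : ℕ) : sr m a * sr m a = 1 := by
  unfold sr
  split_ifs <;> simp

theorem sr_sr (a : ℕ) (i : Fin m) : sr m a (sr m a i) = i := by
  rw [← Equiv.Perm.mul_apply, sr_mul_self, Equiv.Perm.one_apply]

/-- The exchange property: a word whose product has a descent at `i` can be shortened
after multiplying by the simple reflection at `i`. -/
theorem exists_word_mul_sr_of_descent {i : ℕ} (hi : i + 1 < m) (l : List ℕ)
    (hl : ∀ a ∈ l, a + 1 < m)
    (hd : (l.map (sr m)).prod ⟨i + 1, hi⟩ < (l.map (sr m)).prod ⟨i, Nat.lt_of_succ_lt hi⟩) :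
    ∃ l', IsWord m l' ((l.map (sr m)).prod * sr m i) ∧ l'.length + 1 = l.length := by
  induction l with
  | nil => simp [Fin.lt_def] at hd
  | cons a l ih =>
    have ha : a + 1 < m := hl a (by simp)
    have hl' : ∀ b ∈ l, b + 1 < m := fun b hb => hl b (by simp [hb])
    simp only [List.map_cons, List.prod_cons, Equiv.Perm.mul_apply] at hd ⊢
    set q := (l.map (sr m)).prod with hq
    by_cases hqd : q ⟨i + 1, hi⟩ < q ⟨i, Nat.lt_of_succ_lt hi⟩
    · obtain ⟨l', ⟨h1, h2⟩, h3⟩ := ih hl' hqd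
      refine ⟨a :: l', ⟨?_, ?_⟩, by simp [h3]⟩
      · intro b hb
        rcases List.mem_cons.1 hb with rfl | hb
        exacts [ha, h1 b hb]
      · simp [h2, mul_assoc]
    · have hne : q ⟨i + 1, hi⟩ ≠ q ⟨i, Nat.lt_of_succ_lt hi⟩ := by
        simp [Fin.ext_iff]
      rw [Fin.lt_def, val_sr ha, val_sr ha] at hd
      rw [Fin.lt_def] at hqd
      rw [Ne, Fin.ext_iff] at hne
      have e0 : q ⟨i, Nat.lt_of_succ_lt hi⟩ = ⟨a, Nat.lt_of_succ_lt ha⟩ := by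
        rw [Fin.ext_iff]; dsimp only; split_ifs at hd <;> omega
      have e1 : q ⟨i + 1, hi⟩ = ⟨a + 1, ha⟩ := by
        rw [Fin.ext_iff]; dsimp only; split_ifs at hd <;> omega
      refine ⟨l, ⟨hl', ?_⟩, by simp⟩
      have hconj : q * sr m i = sr m a * q := by
        rw [sr_of_lt hi, sr_of_lt ha, ← e0, ← e1, Equiv.mul_swap_eq_swap_mul]
      rw [mul_assoc, hconj, ← mul_assoc, sr_mul_self, one_mul]

theorem exists_gt_le_of_maps {q : Equiv.Perm (Fin m)} {k : ℕ}
    (hq : ∀ i : Fin m, (i : ℕ) ≤ k → (q i : ℕ) ≤ k) (j : Fin m) (hj : k < (j : ℕ)) :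
    k < (q j : ℕ) := by
  by_contra! hc
  let S : Finset (Fin m) := Finset.univ.filter fun i => (i : ℕ) ≤ k
  have hS : S.image q = S := by
    apply Finset.eq_of_subset_of_card_le
    · intro x hx
      obtain ⟨i, hi, rfl⟩ := Finset.mem_image.1 hx
      simp only [S, Finset.mem_filter, Finset.mem_univ, true_and] at hi ⊢
      exact hq i hi
    · rw [Finset.card_image_of_injective _ q.injective]
  have hmem : q j ∈ S.image q := by
    rw [hS]; simpa [S] using hc
  obtain ⟨i, hi, hij⟩ := Finset.mem_image.1 hmem
  rw [q.injective hij] at hi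
  simp only [S, Finset.mem_filter, Finset.mem_univ, true_and] at hi
  omega

/-- A shortest word using the letter `k` has a product not preserving `{0, …, k}`. -/
theorem exists_le_lt_of_shortest {k : ℕ} (l : List ℕ) (hl : ∀ a ∈ l, a + 1 < m)
    (hmin : ∀ l', IsWord m l' (l.map (sr m)).prod → l.length ≤ l'.length) (hk : k ∈ l) :
    ∃ i : Fin m, (i : ℕ) ≤ k ∧ k < ((l.map (sr m)).prod i : ℕ) := by
  induction l using List.reverseRecOn with
  | nil => simp at hk
  | append_singleton l a ih =>
    have ha : a + 1 < m := hl a (by simp)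
    have hl' : ∀ b ∈ l, b + 1 < m := fun b hb => hl b (by simp [hb])
    simp only [List.map_append, List.prod_append, List.map_cons, List.map_nil,
      List.prod_singleton, List.length_append, List.length_singleton] at hmin ih ⊢
    set q := (l.map (sr m)).prod with hq
    have hasc : q ⟨a, Nat.lt_of_succ_lt ha⟩ < q ⟨a + 1, ha⟩ := by
      by_contra! hc
      have hne : q ⟨a + 1, ha⟩ ≠ q ⟨a, Nat.lt_of_succ_lt ha⟩ := by
        simp [Fin.ext_iff]
      obtain ⟨l', h1, h2⟩ := exists_word_mul_sr_of_descent ha l hl' (lt_of_le_of_ne hc hne)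
      have := hmin l' h1
      omega
    by_cases hak : a = k
    · subst hak
      have hpa : sr m a ⟨a, Nat.lt_of_succ_lt ha⟩ = ⟨a + 1, ha⟩ := by
        rw [sr_of_lt ha, Equiv.swap_apply_left]
      by_cases hex : ∃ i : Fin m, (i : ℕ) ≤ a ∧ a < (q i : ℕ)
      · obtain ⟨i, hi, hqi⟩ := hex
        rcases hi.lt_or_eq with h | h
        · refine ⟨i, hi, ?_⟩
          have : sr m a i = i := by
            rw [Fin.ext_iff, val_sr ha]; split_ifs <;> omega
          rwa [Equiv.Perm.mul_apply, this]
        · refine ⟨i, hi, ?_⟩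
          have hi' : i = ⟨a, Nat.lt_of_succ_lt ha⟩ := Fin.ext h
          rw [hi'] at hqi ⊢
          rw [Equiv.Perm.mul_apply, hpa]
          exact hqi.trans hasc
      · push Not at hex
        refine ⟨⟨a, Nat.lt_of_succ_lt ha⟩, le_rfl, ?_⟩
        rw [Equiv.Perm.mul_apply, hpa]
        exact exists_gt_le_of_maps hex _ (Nat.lt_succ_self a)
    · have hkl : k ∈ l := by
        rcases List.mem_append.1 hk with h | h
        · exact h
        · exact absurd (List.mem_singleton.1 h).symm hak
      obtain ⟨i, hi, hqi⟩ := ih hl' (fun l' h' => by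
        have := hmin (l' ++ [a]) ⟨fun b hb => by
          rcases List.mem_append.1 hb with h | h
          · exact h'.1 b h
          · rwa [List.mem_singleton.1 h], by simp [h'.2]⟩
        simp only [List.length_append, List.length_singleton] at this
        omega) hkl
      refine ⟨sr m a i, ?_, ?_⟩
      · rw [val_sr ha]; split_ifs <;> omega
      · rwa [Equiv.Perm.mul_apply, sr_sr]

theorem exists_le_lt_of_mem_supp {v : Equiv.Perm (Fin m)} {k : ℕ} (hk : k ∈ supp v) :
    k + 1 < m ∧ ∃ i : Fin m, (i : ℕ) ≤ k ∧ k < (v i : ℕ) := by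
  obtain ⟨l, ⟨⟨h1, rfl⟩, h3⟩, hkl⟩ := hk
  refine ⟨h1 k hkl, exists_le_lt_of_shortest l h1 (fun l' h' => ?_) hkl⟩
  rw [h3]
  exact Nat.sInf_le ⟨l', h', rfl⟩

end Words

section Cuts

variable {m : ℕ} (v : Equiv.Perm (Fin m))

theorem exists_Mstat_eq {k : ℕ} (hk : k < m) :
    ∃ i : Fin m, (i : ℕ) ≤ k ∧ (v i : ℕ) = Mstat v k :=
  Nat.sSup_mem (s := {x | ∃ i : Fin m, (i : ℕ) ≤ k ∧ (v i : ℕ) = x})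
    ⟨_, ⟨k, hk⟩, le_rfl, rfl⟩ ⟨m, by rintro _ ⟨i, -, rfl⟩; exact (v i).2.le⟩

theorem le_Mstat {k : ℕ} {i : Fin m} (hi : (i : ℕ) ≤ k) : (v i : ℕ) ≤ Mstat v k :=
  le_csSup ⟨m, by rintro _ ⟨i, -, rfl⟩; exact (v i).2.le⟩ ⟨i, hi, rfl⟩

theorem exists_mstat_eq {k : ℕ} (hk : k + 1 < m) :
    ∃ j : Fin m, k < (j : ℕ) ∧ (v j : ℕ) = mstat v k :=
  Nat.sInf_mem (s := {x | ∃ i : Fin m, k < (i : ℕ) ∧ (v i : ℕ) = x})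
    ⟨_, ⟨k + 1, hk⟩, Nat.lt_succ_self k, rfl⟩

theorem mstat_le {k : ℕ} {j : Fin m} (hj : k < (j : ℕ)) : mstat v k ≤ (v j : ℕ) :=
  Nat.sInf_le ⟨j, hj, rfl⟩

theorem mstat_lt_Mstat {k : ℕ} (hk : k ∈ supp v) : mstat v k < Mstat v k := by
  obtain ⟨hkm, i, hi, hki⟩ := exists_le_lt_of_mem_supp hk
  have hM := le_Mstat v hi
  suffices h : ∃ j : Fin m, k < (j : ℕ) ∧ (v j : ℕ) ≤ k by
    obtain ⟨j, hj, hjk⟩ := h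
    have := mstat_le v hj
    omega
  by_contra! hc
  have hinv : ∀ x : Fin m, (x : ℕ) ≤ k → (v⁻¹ x : ℕ) ≤ k := by
    intro x hx
    by_contra! hx'
    have := hc _ hx'
    simp only [Equiv.Perm.coe_inv, Equiv.apply_symm_apply] at this
    omega
  have := exists_gt_le_of_maps hinv (v i) hki
  simp only [Equiv.Perm.coe_inv, Equiv.symm_apply_apply] at this
  omega

end Cuts

section Deletion

variable {n : ℕ} {w : Equiv.Perm (Fin (n + 1))} {wbar : Equiv.Perm (Fin n)}

theorem valAt_val {m : ℕ} (v : Equiv.Perm (Fin m)) (i : Fin m) : valAt v i = v i := by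
  simp [valAt]

theorem posOf_apply {m : ℕ} (v : Equiv.Perm (Fin m)) (i : Fin m) : posOf v (v i) = i := by
  simp [posOf]

theorem IsDeletion.posOf_eq (hdel : IsDeletion w wbar) (i : Fin n) :
    posOf w (wbar i) = if (i : ℕ) < posOf w n then (i : ℕ) else i + 1 := by
  rw [hdel i]
  split_ifs
  · exact (congrArg _ (valAt_val w i.castSucc)).trans (posOf_apply w i.castSucc)
  · have h := valAt_val w i.succ
    rw [Fin.val_succ] at h
    rw [h, posOf_apply, Fin.val_succ]

theorem IsDeletion.lt_posOf_iff (hdel : IsDeletion w wbar) (i : Fin n) :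
    posOf w n < posOf w (wbar i) ↔ posOf w n ≤ i := by
  rw [hdel.posOf_eq]
  split_ifs <;> omega

theorem IsDeletion.isTopOccSet_p321 (hdel : IsDeletion w wbar) {i j : Fin n}
    (hp : posOf w n ≤ i) (hij : i < j) (hv : wbar j < wbar i) :
    IsTopOccSet p321 w {n, (wbar i : ℕ), (wbar j : ℕ)} := by
  have hsucc : ∀ x : Fin n, posOf w n ≤ x → (w x.succ : ℕ) = wbar x := by
    intro x hx
    rw [hdel x, if_neg (by omega), ← valAt_val w x.succ, Fin.val_succ]
  have hi := hsucc i hp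
  have hj := hsucc j (hp.trans hij.le)
  obtain ⟨t, ht⟩ := w.surjective (Fin.last n)
  have htp : posOf w n = t := by
    have := posOf_apply w t
    rwa [ht, Fin.val_last] at this
  have hwt : (w t : ℕ) = n := by rw [ht, Fin.val_last]
  have hti : t < i.succ := by rw [Fin.lt_def, Fin.val_succ]; omega
  have hwi : w i.succ < w t := by rw [Fin.lt_def, hi, hwt]; exact (wbar i).2
  have hwj : w j.succ < w i.succ := by rwa [Fin.lt_def, hi, hj]
  refine ⟨⟨![t, i.succ, j.succ], ?_, ?_, ?_⟩, by simp⟩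
  · rw [Fin.strictMono_iff_lt_succ]
    intro a
    fin_cases a <;> simp [hti, hij]
  · intro a b
    fin_cases a <;> fin_cases b <;>
      simp [p321, hwi, hwj, hwj.trans hwi, hwi.le, hwj.le, (hwj.trans hwi).le]
  · ext x
    simp [Fin.exists_fin_succ, hi, hj, hwt, eq_comm]

end Deletion

theorem triple_eq_of_lt {n a b c d : ℕ} (hb : b < a) (hd : d < c) (hc : c < n)
    (h : ({n, a, b} : Finset ℕ) = {n, c, d}) : a = c ∧ b = d := by
  have h1 : a ∈ ({n, c, d} : Finset ℕ) := h ▸ by simp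
  have h2 : b ∈ ({n, c, d} : Finset ℕ) := h ▸ by simp
  have h3 : c ∈ ({n, a, b} : Finset ℕ) := h ▸ by simp
  have h4 : d ∈ ({n, a, b} : Finset ℕ) := h ▸ by simp
  simp only [Finset.mem_insert, Finset.mem_singleton] at h1 h2 h3 h4
  omega

theorem quadruple_ne_triple {n a b c d e : ℕ} (hb : b < c) (hc : c < a) (ha : a < n) :
    ({a, n, b, c} : Finset ℕ) ≠ {n, d, e} := by
  intro h
  have h1 : a ∈ ({n, d, e} : Finset ℕ) := h ▸ by simp
  have h2 : b ∈ ({n, d, e} : Finset ℕ) := h ▸ by simp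
  have h3 : c ∈ ({n, d, e} : Finset ℕ) := h ▸ by simp
  simp only [Finset.mem_insert, Finset.mem_singleton] at h1 h2 h3
  omega

theorem eq_of_quadruple_eq {n a b c a' b' c' : ℕ} (hb : b < c) (hc : c < a) (ha : a < n)
    (hb' : b' < c') (hc' : c' < a') (ha' : a' < n)
    (h : ({a, n, b, c} : Finset ℕ) = {a', n, b', c'}) : b = b' := by
  have h1 : b ∈ ({a', n, b', c'} : Finset ℕ) := h ▸ by simp
  have h2 : b' ∈ ({a, n, b, c} : Finset ℕ) := h ▸ by simp
  simp only [Finset.mem_insert, Finset.mem_singleton] at h1 h2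
  omega

/-- The three cases in the definition of `pocc`, together with the order of the
letters involved. -/
theorem pocc_cases {n : ℕ} {w : Equiv.Perm (Fin (n + 1))} {wbar : Equiv.Perm (Fin n)}
    (hdel : IsDeletion w wbar) {k : Fin n} (hk : (k : ℕ) ∈ newrep w wbar) :
    (posOf w n < posOf w (Mstat wbar k) ∧ mstat wbar k < Mstat wbar k ∧
      pocc w wbar k = {n, Mstat wbar k, mstat wbar k}) ∨
    (¬ posOf w n < posOf w (Mstat wbar k) ∧ (wbar k : ℕ) < Mstat wbar k ∧
      mstat wbar k < wbar k ∧ pocc w wbar k = {n, (wbar k : ℕ), mstat wbar k}) ∨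
    ((wbar k : ℕ) < mstat wbar k ∧ mstat wbar k < Mstat wbar k ∧
      pocc w wbar k = {Mstat wbar k, n, (wbar k : ℕ), mstat wbar k}) := by
  obtain ⟨hks, hpk⟩ := hk
  have hmM := mstat_lt_Mstat wbar hks
  obtain ⟨j, hj, hjm⟩ := exists_mstat_eq wbar (exists_le_lt_of_mem_supp hks).1
  unfold pocc
  rw [valAt_val]
  split_ifs with h1 h2
  · exact Or.inl ⟨h1, hmM, rfl⟩
  · refine Or.inr (Or.inl ⟨h1, lt_of_le_of_ne (le_Mstat wbar le_rfl) fun h => h1 ?_, h2, rfl⟩)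
    rwa [← h, hdel.lt_posOf_iff]
  · refine Or.inr (Or.inr ⟨lt_of_le_of_ne (not_lt.1 h2) fun h => ?_, hmM, rfl⟩)
    rw [← hjm] at h
    have := wbar.injective (Fin.ext h)
    omega

theorem Mstat_lt {m : ℕ} (v : Equiv.Perm (Fin m)) {k : ℕ} (hk : k < m) : Mstat v k < m := by
  obtain ⟨i, -, hi⟩ := exists_Mstat_eq v hk
  exact hi ▸ (v i).2

/-- Coinciding patterns at `k < k'` are both of the first kind. -/
theorem eq_stats_of_pocc_eq {n : ℕ} {w : Equiv.Perm (Fin (n + 1))} {wbar : Equiv.Perm (Fin n)}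
    (hdel : IsDeletion w wbar) {k k' : Fin n} (hk : (k : ℕ) ∈ newrep w wbar)
    (hk' : (k' : ℕ) ∈ newrep w wbar) (hlt : k < k') (heq : pocc w wbar k = pocc w wbar k') :
    posOf w n < posOf w (Mstat wbar k') ∧ Mstat wbar k = Mstat wbar k' ∧
      mstat wbar k = mstat wbar k' := by
  have hM := Mstat_lt wbar k.2
  have hM' := Mstat_lt wbar k'.2
  obtain ⟨i, hi, hiM⟩ := exists_Mstat_eq wbar k.2
  have hMM : Mstat wbar k ≤ Mstat wbar k' := hiM ▸ le_Mstat wbar (hi.trans hlt.le)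
  have hinj : ∀ {a : Fin n}, (wbar a : ℕ) = wbar k' → a = k' := fun h =>
    wbar.injective (Fin.ext h)
  rcases pocc_cases hdel hk with ⟨a1, a2, a3⟩ | ⟨a1, a2, a3, a4⟩ | ⟨a1, a2, a3⟩ <;>
  rcases pocc_cases hdel hk' with ⟨b1, b2, b3⟩ | ⟨b1, b2, b3, b4⟩ | ⟨b1, b2, b3⟩
  · rw [a3, b3] at heq
    exact ⟨b1, triple_eq_of_lt a2 b2 hM' heq⟩
  · rw [a3, b4] at heq
    have h := (triple_eq_of_lt a2 b3 (b2.trans hM') heq).1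
    have := hinj (hiM.trans h)
    rw [this] at hi
    exact absurd hi hlt.not_ge
  · rw [a3, b3] at heq
    exact absurd heq.symm (quadruple_ne_triple b1 b2 hM')
  · rw [a4, b3] at heq
    have h := (triple_eq_of_lt a3 b2 hM' heq).1
    omega
  · rw [a4, b4] at heq
    have h := (triple_eq_of_lt a3 b3 (b2.trans hM') heq).1
    exact absurd (hinj h) hlt.ne
  · rw [a4, b3] at heq
    exact absurd heq.symm (quadruple_ne_triple b1 b2 hM')
  · rw [a3, b3] at heq
    exact absurd heq (quadruple_ne_triple a1 a2 hM)
  · rw [a3, b4] at heq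
    exact absurd heq (quadruple_ne_triple a1 a2 hM)
  · rw [a3, b3] at heq
    exact absurd (hinj (eq_of_quadruple_eq a1 a2 hM b1 b2 hM' heq)) hlt.ne

/-- if distinct `k < k'` in `newrep(w)` give the same pattern, then
`{N, M_{k'}, wbar(k')}` and `{N, wbar(k'), m_{k'}}` are two distinct `N`-occurrences
of 321 in `w`, and neither is equal to `𝔭_j(w)` for any `j ∈ newrep(w)`. -/
theorem extra_321_occurrences {n : ℕ} (w : Equiv.Perm (Fin (n + 1)))
    (wbar : Equiv.Perm (Fin n)) (hdel : IsDeletion w wbar) (k k' : ℕ)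
    (hk : k ∈ newrep w wbar) (hk' : k' ∈ newrep w wbar) (hlt : k < k')
    (heq : pocc w wbar k = pocc w wbar k') :
    IsTopOccSet p321 w {n, Mstat wbar k', valAt wbar k'} ∧
    IsTopOccSet p321 w {n, valAt wbar k', mstat wbar k'} ∧
    ({n, Mstat wbar k', valAt wbar k'} : Finset ℕ) ≠ {n, valAt wbar k', mstat wbar k'} ∧
    ∀ j ∈ newrep w wbar, pocc w wbar j ≠ {n, Mstat wbar k', valAt wbar k'} ∧
      pocc w wbar j ≠ {n, valAt wbar k', mstat wbar k'} := by
  have hkn := (exists_le_lt_of_mem_supp hk'.1).1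
  lift k' to Fin n using by omega
  lift k to Fin n using by omega
  obtain ⟨hpos, hMM, hmm⟩ := eq_stats_of_pocc_eq hdel hk hk' hlt heq
  rw [valAt_val]
  obtain ⟨i, hi, hiM⟩ := exists_Mstat_eq wbar k.2
  obtain ⟨j, hj, hjm⟩ := exists_mstat_eq wbar hkn
  rw [hMM] at hiM
  have hik : i < k' := lt_of_le_of_lt (Fin.le_def.2 hi) hlt
  have hMlt := Mstat_lt wbar k'.2
  have hvM : (wbar k' : ℕ) < Mstat wbar k' := by
    refine lt_of_le_of_ne (le_Mstat wbar le_rfl) fun h => hik.ne' ?_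
    exact wbar.injective (Fin.ext (h.trans hiM.symm))
  have hmv : mstat wbar k' < wbar k' := by
    refine lt_of_le_of_ne (hmm ▸ mstat_le wbar hlt) fun h => (Fin.ne_of_gt hj) ?_
    exact wbar.injective (Fin.ext (hjm.trans h))
  refine ⟨?_, ?_, ?_, fun a ha => ?_⟩
  · rw [← hiM, hdel.lt_posOf_iff] at hpos
    rw [← hiM] at hvM ⊢
    exact hdel.isTopOccSet_p321 hpos hik hvM
  · rw [← hjm] at hmv ⊢
    exact hdel.isTopOccSet_p321 hk'.2 hj hmv
  · intro h
    have := (triple_eq_of_lt hvM hmv (hvM.trans hMlt) h).1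
    omega
  · have han := (exists_le_lt_of_mem_supp ha.1).1
    lift a to Fin n using by omega
    have hMa := Mstat_lt wbar a.2
    have hm_ne : mstat wbar a ≠ wbar k' := by
      intro h
      obtain ⟨b, hb, hbm⟩ := exists_mstat_eq wbar han
      have hbk : b = k' := wbar.injective (Fin.ext (hbm.trans h))
      have := mstat_le wbar (hbk ▸ hb |>.trans hj)
      omega
    have hM_ne : Mstat wbar a ≠ wbar k' := by
      intro h
      obtain ⟨b, hb, hbM⟩ := exists_Mstat_eq wbar a.2
      have hbk : b = k' := wbar.injective (Fin.ext (hbM.trans h))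
      have := le_Mstat wbar (hik.le.trans (hbk ▸ hb))
      omega
    rcases pocc_cases hdel ha with ⟨a1, a2, a3⟩ | ⟨a1, a2, a3, a4⟩ | ⟨a1, a2, a3⟩
    · rw [a3]
      exact ⟨fun h => hm_ne (triple_eq_of_lt a2 hvM hMlt h).2,
        fun h => hM_ne (triple_eq_of_lt a2 hmv (hvM.trans hMlt) h).1⟩
    · rw [a4]
      refine ⟨fun h => hm_ne (triple_eq_of_lt a3 hvM hMlt h).2, fun h => a1 ?_⟩
      have h := (triple_eq_of_lt a3 hmv (hvM.trans hMlt) h).1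
      rwa [wbar.injective (Fin.ext h)]
    · rw [a3]
      exact ⟨quadruple_ne_triple a1 a2 hMa, quadruple_ne_triple a1 a2 hMa⟩
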